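/- arXiv:2105.03130 — 2 statements merged into one kernel-verified Lean document; each statement's English description precedes it below -/
import Mathlib

section
/- Let $(X,\mathcal{B}_X,\mu,T)$ be a $\mathbb{Z}^q$-MPS ($q\ge 2$) and $\alpha$ a finite measurable partition of $X$. If there exists an infinite subset $S$ of $\mathbb{Z}^q$ such that $h^S_\mu(T,\alpha)>0$, then there are at most $q-1$ linearly independent direction vectors $\vec v_1,\dots,\vec v_{q-1}$ of the form $\vec v_i=(1,\beta^i_2,\dots,\beta^i_q)\in\mathbb{R}^q$ such that $h^{\vec v_i,*}_\mu(\alpha)=0$ for all $i$. -/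
open MeasureTheory Filter Set
open scoped ENNReal Topology

namespace Directional

noncomputable section

attribute [local instance] Classical.propDecidable

variable {X : Type*} [MeasurableSpace X] {G : Type*}

/-- The set of Koopman images `U_T^w 1_B` for `w ∈ Λ`, as elements of `L²(μ)`. -/
def korbit (μ : Measure X) (T : G → X → X) (Λ : Set G) (B : Set X) :
    Set (Lp ℝ 2 μ) :=
  {g | ∃ w ∈ Λ, (g : X → ℝ) =ᵐ[μ] fun x => B.indicator (fun _ => (1 : ℝ)) (T w x)}

/-- A finite measurable partition of `X`. -/
def IsPartition (α : Finset (Set X)) : Prop :=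
  (∀ A ∈ α, MeasurableSet A) ∧ ((α : Set (Set X)).PairwiseDisjoint id) ∧
    ⋃₀ (α : Set (Set X)) = Set.univ

/-- Static entropy `H_μ(α) = -∑ μ(A) log μ(A)`. -/
def partEnt (μ : Measure X) (α : Finset (Set X)) : ℝ :=
  ∑ A ∈ α, Real.negMulLog (μ A).toReal

/-- The join `⋁_{i=1}^k T^{-w_i} α`. -/
def seqJoin (T : G → X → X) (w : ℕ → G) (α : Finset (Set X)) : ℕ → Finset (Set X)
  | 0 => {Set.univ}
  | k + 1 => ((seqJoin T w α k) ×ˢ α).image fun p => p.1 ∩ (T (w k) ⁻¹' p.2)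

/-- Sequence entropy `h^S_μ(T, α)` along the sequence `w` for the partition `α`. -/
def seqEnt (μ : Measure X) (T : G → X → X) (w : ℕ → G) (α : Finset (Set X)) : ℝ :=
  Filter.atTop.limsup fun k : ℕ => partEnt μ (seqJoin T w α k) / (k : ℝ)

/-- Sequence entropy `h^S_μ(T)`, as the supremum over all finite measurable
partitions (valued in `ℝ≥0∞`). -/
def seqEntSup (μ : Measure X) (T : G → X → X) (w : ℕ → G) : ℝ≥0∞ :=
  ⨆ α : {α : Finset (Set X) // IsPartition α}, ENNReal.ofReal (seqEnt μ T w α)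

/-- `w : ℕ → G` is an enumeration of an infinite subset of `Λ`. -/
def EnumIn (w : ℕ → G) (Λ : Set G) : Prop :=
  Function.Injective w ∧ ∀ i, w i ∈ Λ

/-- Conditional entropy `H_μ(α | F)` with respect to a sub-σ-algebra `F`. -/
def condEntAlg (μ : Measure X) (F : MeasurableSpace X) (α : Finset (Set X)) : ℝ :=
  ∑ A ∈ α, ∫ x, Real.negMulLog ((μ[A.indicator (fun _ => (1 : ℝ)) | F]) x) ∂μ

/-- Conditional entropy `H_μ(α | η)` of a partition given another partition. -/
def condEntPart (μ : Measure X) (α η : Finset (Set X)) : ℝ :=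
  -∑ A ∈ α, ∑ D ∈ η,
    (μ (A ∩ D)).toReal * Real.log ((μ (A ∩ D)).toReal / (μ D).toReal)

/-- A `ℤ²`-measure-preserving system: an action of `ℤ²` by homeomorphisms
(continuous maps with continuous inverses `T (-w)`), preserving `μ`. -/
def IsZ2MPS [TopologicalSpace X] (μ : Measure X) (T : ℤ × ℤ → X → X) : Prop :=
  (∀ w, Continuous (T w)) ∧ T 0 = _root_.id ∧ (∀ v w, T (v + w) = T v ∘ T w) ∧
    ∀ w, MeasurePreserving (T w) μ μ

/-- The strip `Λ^{(1,β)}(b) = {(m,n) : βm - b/2 ≤ n ≤ βm + b/2}`. -/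
def Lam (β b : ℝ) : Set (ℤ × ℤ) :=
  {p | β * (p.1 : ℝ) - b / 2 ≤ (p.2 : ℝ) ∧ (p.2 : ℝ) ≤ β * (p.1 : ℝ) + b / 2}

/-- The `(1,β)`-directional Kronecker algebra with width parameter `b`. -/
def dirKron (μ : Measure X) (T : ℤ × ℤ → X → X) (β b : ℝ) : Set (Set X) :=
  {B | MeasurableSet B ∧ IsCompact (closure (korbit μ T (Lam β b) B))}

/-- The directional Kronecker algebra as a σ-algebra (using width `b = 1`,
which is immaterial since `dirKron` is independent of `b`). -/
def dirKronAlg (μ : Measure X) (T : ℤ × ℤ → X → X) (β : ℝ) : MeasurableSpace X :=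
  MeasurableSpace.generateFrom (dirKron μ T β 1)

/-- The classical Kronecker algebra of the `ℤ²`-system. -/
def kron (μ : Measure X) (T : ℤ × ℤ → X → X) : Set (Set X) :=
  {B | MeasurableSet B ∧ IsCompact (closure (korbit μ T Set.univ B))}

/-- `h^{v,*}_μ(α)`: supremum of directional sequence entropies of `α` over all
infinite subsets of the strip (width `1`, immaterial). -/
def hStar (μ : Measure X) (T : ℤ × ℤ → X → X) (β : ℝ) (α : Finset (Set X)) : ℝ :=
  ⨆ w : {w : ℕ → ℤ × ℤ // EnumIn w (Lam β 1)}, seqEnt μ T w.1 α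

/-- The two-element partition `{B, Bᶜ}`. -/
def pairPart (B : Set X) : Finset (Set X) := {B, Bᶜ}

/-- The pulled-back partition `T^{-g} α = {T_g⁻¹ A : A ∈ α}`. -/
def pullPart (T : G → X → X) (g : G) (α : Finset (Set X)) : Finset (Set X) :=
  α.image fun A => T g ⁻¹' A

end

section Zq

variable {X : Type*} [MeasurableSpace X] {q : ℕ} [NeZero q]

/-- A `ℤ^q`-measure-preserving system: an action of `ℤ^q` by homeomorphisms
preserving `μ`. -/
def IsZqMPS [TopologicalSpace X] (μ : Measure X) (T : (Fin q → ℤ) → X → X) : Prop :=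
  (∀ w, Continuous (T w)) ∧ T 0 = _root_.id ∧ (∀ v w, T (v + w) = T v ∘ T w) ∧
    ∀ w, MeasurePreserving (T w) μ μ

/-- The tube `Λ^{(1,β₂,…,β_q)}(b) ⊆ ℤ^q`. -/
def LamQ (β b : Fin q → ℝ) : Set (Fin q → ℤ) :=
  {w | ∀ i : Fin q, i ≠ 0 →
    (β i * (w 0 : ℝ) - b i / 2 ≤ (w i : ℝ) ∧ (w i : ℝ) ≤ β i * (w 0 : ℝ) + b i / 2)}

/-- The directional Kronecker algebra of a `ℤ^q`-system along `(1,β₂,…,β_q)`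
with width parameter `b`. -/
def dirKronQ (μ : Measure X) (T : (Fin q → ℤ) → X → X) (β b : Fin q → ℝ) :
    Set (Set X) :=
  {B | MeasurableSet B ∧ IsCompact (closure (korbit μ T (LamQ β b) B))}

/-- The directional Kronecker algebra as a σ-algebra (width `1`, immaterial). -/
def dirKronAlgQ (μ : Measure X) (T : (Fin q → ℤ) → X → X) (β : Fin q → ℝ) :
    MeasurableSpace X :=
  MeasurableSpace.generateFrom (dirKronQ μ T β fun _ => 1)

/-- The classical Kronecker algebra of a `ℤ^q`-system. -/
def kronQ (μ : Measure X) (T : (Fin q → ℤ) → X → X) : Set (Set X) :=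
  {B | MeasurableSet B ∧ IsCompact (closure (korbit μ T Set.univ B))}

/-- `h^{v,*}_μ(α)` for a `ℤ^q`-system: the supremum of directional sequence
entropies of `α` over all infinite subsets of the tube (width `1`,
immaterial). -/
noncomputable def hStarQ (μ : Measure X) (T : (Fin q → ℤ) → X → X) (β : Fin q → ℝ)
    (α : Finset (Set X)) : ℝ :=
  ⨆ w : {w : ℕ → Fin q → ℤ // EnumIn w (LamQ β fun _ => 1)}, seqEnt μ T w.1 α

end Zq

section PartitionEntropy

attribute [local instance] Classical.propDecidable

variable {X : Type*}

/-- The join of `ζ` with the pullback of `α` under `f`. -/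
noncomputable def pullJoin (f : X → X) (ζ α : Finset (Set X)) : Finset (Set X) :=
  (ζ ×ˢ α).image fun p => p.1 ∩ f ⁻¹' p.2

theorem mem_pullJoin {f : X → X} {ζ α : Finset (Set X)} {S : Set X} :
    S ∈ pullJoin f ζ α ↔ ∃ D ∈ ζ, ∃ A ∈ α, D ∩ f ⁻¹' A = S := by
  simp only [pullJoin, Finset.mem_image, Finset.mem_product, Prod.exists]
  constructor
  · rintro ⟨D, A, ⟨hD, hA⟩, rfl⟩
    exact ⟨D, hD, A, hA, rfl⟩
  · rintro ⟨D, hD, A, hA, rfl⟩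
    exact ⟨D, A, ⟨hD, hA⟩, rfl⟩

theorem pullJoin_id_pullJoin (f : X → X) (ζ α η : Finset (Set X)) :
    pullJoin id (pullJoin f ζ α) η = pullJoin f (pullJoin id ζ η) α := by
  ext S
  simp only [mem_pullJoin]
  constructor
  · rintro ⟨_, ⟨D, hD, A, hA, rfl⟩, E, hE, rfl⟩
    exact ⟨_, ⟨D, hD, E, hE, rfl⟩, A, hA, inter_right_comm _ _ _⟩
  · rintro ⟨_, ⟨D, hD, E, hE, rfl⟩, A, hA, rfl⟩
    exact ⟨_, ⟨D, hD, A, hA, rfl⟩, E, hE, inter_right_comm _ _ _⟩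

variable [MeasurableSpace X]

/-- The conditional entropy of the pullback of `α` under `f`, given `ζ`. -/
noncomputable def pullCondEnt (μ : Measure X) (f : X → X) (ζ α : Finset (Set X)) : ℝ :=
  ∑ D ∈ ζ, μ.real D * ∑ A ∈ α, Real.negMulLog (μ.real (D ∩ f ⁻¹' A) / μ.real D)

/-- The mean conditional variance of the atoms of the pullback of `α` under `f`, given `ζ`. -/
noncomputable def pullCondVar (μ : Measure X) (f : X → X) (ζ α : Finset (Set X)) : ℝ :=
  ∑ D ∈ ζ, μ.real D * ∑ A ∈ α,
    (μ.real (D ∩ f ⁻¹' A) / μ.real D) * (1 - μ.real (D ∩ f ⁻¹' A) / μ.real D)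

/-- The distance between the pullbacks of `α` under `f` and under `g`. -/
noncomputable def pullDist (μ : Measure X) (α : Finset (Set X)) (f g : X → X) : ℝ :=
  ∑ A ∈ α, μ.real (symmDiff (f ⁻¹' A) (g ⁻¹' A))

theorem pairwiseDisjoint_inter_preimage {f : X → X} {ζ α : Finset (Set X)}
    (hζ : IsPartition ζ) (hα : IsPartition α) :
    ((ζ ×ˢ α : Finset (Set X × Set X)) : Set (Set X × Set X)).PairwiseDisjoint
      fun p => p.1 ∩ f ⁻¹' p.2 := by
  rintro ⟨D, A⟩ h ⟨D', A'⟩ h' hne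
  simp only [Finset.coe_product, mem_prod, Finset.mem_coe] at h h'
  by_cases hD : D = D'
  · have hA : A ≠ A' := by
      rintro rfl
      exact hne (by rw [hD])
    exact (Disjoint.preimage f (hα.2.1 h.2 h'.2 hA)).mono inter_subset_right inter_subset_right
  · exact Disjoint.mono inter_subset_left inter_subset_left (hζ.2.1 h.1 h'.1 hD)

theorem IsPartition.pullJoin {f : X → X} {ζ α : Finset (Set X)} (hf : Measurable f)
    (hζ : IsPartition ζ) (hα : IsPartition α) : IsPartition (pullJoin f ζ α) := by
  refine ⟨?_, ?_, ?_⟩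
  · intro S hS
    obtain ⟨D, hD, A, hA, rfl⟩ := mem_pullJoin.1 hS
    exact (hζ.1 D hD).inter (hf (hα.1 A hA))
  · intro S hS S' hS' hne
    obtain ⟨D, hD, A, hA, rfl⟩ := mem_pullJoin.1 hS
    obtain ⟨D', hD', A', hA', rfl⟩ := mem_pullJoin.1 hS'
    refine pairwiseDisjoint_inter_preimage (f := f) hζ hα
      (Finset.mem_coe.2 (Finset.mk_mem_product hD hA))
      (Finset.mem_coe.2 (Finset.mk_mem_product hD' hA')) ?_
    rintro h
    obtain ⟨rfl, rfl⟩ := Prod.mk.inj h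
    exact hne rfl
  · refine eq_univ_of_forall fun x => ?_
    obtain ⟨D, hD, hx⟩ : x ∈ ⋃₀ (ζ : Set (Set X)) := hζ.2.2 ▸ mem_univ x
    obtain ⟨A, hA, hx'⟩ : f x ∈ ⋃₀ (α : Set (Set X)) := hα.2.2 ▸ mem_univ (f x)
    exact ⟨D ∩ f ⁻¹' A, mem_pullJoin.2 ⟨D, hD, A, hA, rfl⟩, hx, hx'⟩

theorem isPartition_singleton_univ : IsPartition ({univ} : Finset (Set X)) := by
  refine ⟨by simp, by simp, by simp⟩

variable {μ : Measure X} {f g : X → X} {ζ α : Finset (Set X)}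

theorem pullDist_self : pullDist μ α f f = 0 := by simp [pullDist]

theorem pullDist_comp {k : X → X} (hf : Measurable f) (hg : Measurable g)
    (hk : MeasurePreserving k μ μ) (hα : IsPartition α) :
    pullDist μ α (f ∘ k) (g ∘ k) = pullDist μ α f g := by
  refine Finset.sum_congr rfl fun A hA => ?_
  have hA := hα.1 A hA
  rw [preimage_comp, preimage_comp, ← preimage_symmDiff,
    hk.measureReal_preimage ((hf hA).symmDiff (hg hA)).nullMeasurableSet]

variable [IsProbabilityMeasure μ]

theorem sum_measureReal_inter_preimage (hf : Measurable f) (hα : IsPartition α) (S : Set X) :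
    ∑ A ∈ α, μ.real (S ∩ f ⁻¹' A) = μ.real S := by
  have h1 : ∀ A ∈ α, μ.real (S ∩ f ⁻¹' A) = (μ.restrict S).real (f ⁻¹' A) := fun A hA => by
    rw [measureReal_restrict_apply (hf (hα.1 A hA)), inter_comm]
  rw [Finset.sum_congr rfl h1, ← measureReal_biUnion_finset (f := fun A => f ⁻¹' A)
    (fun A hA B hB hne => Disjoint.preimage f (hα.2.1 hA hB hne)) fun A hA => hf (hα.1 A hA)]
  have h2 : ⋃ A ∈ α, f ⁻¹' A = univ := by
    rw [← preimage_univ (f := f), ← hα.2.2, sUnion_eq_biUnion, preimage_iUnion₂]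
    rfl
  rw [h2, measureReal_restrict_apply_univ]

theorem sum_measureReal_inter (hζ : IsPartition ζ) (S : Set X) :
    ∑ D ∈ ζ, μ.real (D ∩ S) = μ.real S := by
  simpa [inter_comm] using sum_measureReal_inter_preimage (μ := μ) measurable_id hζ S

theorem sum_measureReal_eq_one (hζ : IsPartition ζ) : ∑ D ∈ ζ, μ.real D = 1 := by
  simpa using sum_measureReal_inter (μ := μ) hζ univ

theorem measureReal_inter_div_mem (D S : Set X) : μ.real (D ∩ S) / μ.real D ∈ Icc (0 : ℝ) 1 :=
  ⟨by positivity, div_le_one_of_le₀ (measureReal_mono inter_subset_left) measureReal_nonneg⟩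

theorem measureReal_mul_div_inter (D S : Set X) :
    μ.real D * (μ.real (D ∩ S) / μ.real D) = μ.real (D ∩ S) := by
  by_cases h : μ.real D = 0
  · have : μ.real (D ∩ S) = 0 :=
      le_antisymm (h ▸ measureReal_mono inter_subset_left) measureReal_nonneg
    simp [h, this]
  · field_simp

theorem partEnt_pullJoin (hf : Measurable f) (hζ : IsPartition ζ) (hα : IsPartition α) :
    partEnt μ (pullJoin f ζ α) = partEnt μ ζ + pullCondEnt μ f ζ α := by
  have h : partEnt μ (pullJoin f ζ α)
      = ∑ D ∈ ζ, ∑ A ∈ α, Real.negMulLog (μ.real (D ∩ f ⁻¹' A)) := by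
    unfold partEnt pullJoin
    rw [Finset.sum_image_of_disjoint (by simp) (pairwiseDisjoint_inter_preimage hζ hα),
      Finset.sum_product]
    rfl
  rw [h]
  unfold partEnt pullCondEnt
  rw [← Finset.sum_add_distrib]
  refine Finset.sum_congr rfl fun D _ => ?_
  have h1 : ∀ A ∈ α, Real.negMulLog (μ.real (D ∩ f ⁻¹' A))
      = (μ.real (D ∩ f ⁻¹' A) / μ.real D) * Real.negMulLog (μ.real D)
        + μ.real D * Real.negMulLog (μ.real (D ∩ f ⁻¹' A) / μ.real D) := fun A _ => by
    rw [← Real.negMulLog_mul, measureReal_mul_div_inter]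
  rw [Finset.sum_congr rfl h1, Finset.sum_add_distrib, ← Finset.sum_mul, ← Finset.mul_sum,
    ← Finset.sum_div, sum_measureReal_inter_preimage hf hα]
  congr 1
  by_cases hD : μ.real D = 0
  · have : (μ D).toReal = 0 := hD
    simp [hD, this]
  · rw [div_self hD, one_mul]
    rfl

theorem pullCondEnt_nonneg : 0 ≤ pullCondEnt μ f ζ α :=
  Finset.sum_nonneg fun D _ => mul_nonneg measureReal_nonneg <| Finset.sum_nonneg fun _ _ =>
    Real.negMulLog_nonneg (measureReal_inter_div_mem D _).1 (measureReal_inter_div_mem D _).2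

theorem pullCondEnt_le_card (hζ : IsPartition ζ) : pullCondEnt μ f ζ α ≤ α.card := by
  have h : ∀ D ∈ ζ, μ.real D * ∑ A ∈ α, Real.negMulLog (μ.real (D ∩ f ⁻¹' A) / μ.real D)
      ≤ μ.real D * α.card := fun D _ => by
    refine mul_le_mul_of_nonneg_left ?_ measureReal_nonneg
    refine (Finset.sum_le_card_nsmul _ _ 1 fun A _ => ?_).trans (by simp)
    have h0 := (measureReal_inter_div_mem (μ := μ) D (f ⁻¹' A)).1
    linarith [Real.negMulLog_le_one_sub_self h0]
  refine (Finset.sum_le_sum h).trans ?_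
  rw [← Finset.sum_mul, sum_measureReal_eq_one hζ, one_mul]

theorem mul_one_sub_le_negMulLog {t : ℝ} (ht : 0 ≤ t) : t * (1 - t) ≤ Real.negMulLog t := by
  rcases ht.eq_or_lt with rfl | ht
  · simp
  · have := Real.log_le_sub_one_of_pos ht
    unfold Real.negMulLog
    nlinarith

theorem pullCondVar_le_pullCondEnt : pullCondVar μ f ζ α ≤ pullCondEnt μ f ζ α :=
  Finset.sum_le_sum fun D _ => mul_le_mul_of_nonneg_left
    (Finset.sum_le_sum fun _ _ => mul_one_sub_le_negMulLog (measureReal_inter_div_mem D _).1)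
    measureReal_nonneg

theorem negMulLog_le_add_mul {s t : ℝ} (hs : 0 < s) (ht : 0 ≤ t) :
    Real.negMulLog t ≤ s + t * -Real.log s := by
  rcases ht.eq_or_lt with rfl | ht
  · simpa using hs.le
  · have h := Real.log_le_sub_one_of_pos (div_pos hs ht)
    rw [Real.log_div hs.ne' ht.ne'] at h
    have h2 := mul_le_mul_of_nonneg_left h ht.le
    have h3 : t * (s / t - 1) = s - t := by field_simp
    unfold Real.negMulLog
    nlinarith

theorem pullDist_triangle (f g k : X → X) :
    pullDist μ α f k ≤ pullDist μ α f g + pullDist μ α g k := by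
  unfold pullDist
  rw [← Finset.sum_add_distrib]
  refine Finset.sum_le_sum fun A _ => measureReal_symmDiff_le _

theorem sum_inter_symmDiff_eq_pullDist (hζ : IsPartition ζ) :
    ∑ D ∈ ζ, ∑ A ∈ α, μ.real (D ∩ symmDiff (f ⁻¹' A) (g ⁻¹' A)) = pullDist μ α f g := by
  rw [Finset.sum_comm]
  exact Finset.sum_congr rfl fun A _ => sum_measureReal_inter hζ _

theorem pullDist_le_of_half_iff (hf : Measurable f) (hg : Measurable g) (hζ : IsPartition ζ)
    (hα : IsPartition α)
    (h : ∀ D ∈ ζ, ∀ A ∈ α, μ.real D / 2 ≤ μ.real (D ∩ f ⁻¹' A) ↔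
      μ.real D / 2 ≤ μ.real (D ∩ g ⁻¹' A)) :
    pullDist μ α f g ≤ 2 * pullCondVar μ f ζ α + 2 * pullCondVar μ g ζ α := by
  rw [← sum_inter_symmDiff_eq_pullDist hζ]
  unfold pullCondVar
  simp only [Finset.mul_sum]
  rw [← Finset.sum_add_distrib]
  refine Finset.sum_le_sum fun D hD => ?_
  rw [← Finset.sum_add_distrib]
  refine Finset.sum_le_sum fun A hA => ?_
  have hfm := measureReal_inter_add_sdiff (μ := μ) (s := D) (hf (hα.1 A hA))
  have hgm := measureReal_inter_add_sdiff (μ := μ) (s := D) (hg (hα.1 A hA))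
  have hp := measureReal_mul_div_inter (μ := μ) D (f ⁻¹' A)
  have hp' := measureReal_mul_div_inter (μ := μ) D (g ⁻¹' A)
  obtain ⟨hp0, hp1⟩ := measureReal_inter_div_mem (μ := μ) D (f ⁻¹' A)
  obtain ⟨hq0, hq1⟩ := measureReal_inter_div_mem (μ := μ) D (g ⁻¹' A)
  have hsub1 : μ.real (D ∩ symmDiff (f ⁻¹' A) (g ⁻¹' A)) ≤
      μ.real (D ∩ f ⁻¹' A) + μ.real (D ∩ g ⁻¹' A) := by
    refine (measureReal_mono ?_).trans (measureReal_union_le _ _)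
    rintro x ⟨hx, hx' | hx'⟩
    exacts [Or.inl ⟨hx, hx'.1⟩, Or.inr ⟨hx, hx'.1⟩]
  have hsub2 : μ.real (D ∩ symmDiff (f ⁻¹' A) (g ⁻¹' A)) ≤
      μ.real (D \ f ⁻¹' A) + μ.real (D \ g ⁻¹' A) := by
    refine (measureReal_mono ?_).trans (measureReal_union_le _ _)
    rintro x ⟨hx, hx' | hx'⟩
    exacts [Or.inr ⟨hx, hx'.2⟩, Or.inl ⟨hx, hx'.2⟩]
  have hm : 0 ≤ μ.real D := measureReal_nonneg
  specialize h D hD A hA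
  generalize μ.real (D ∩ f ⁻¹' A) / μ.real D = p at *
  generalize μ.real (D ∩ g ⁻¹' A) / μ.real D = r at *
  rw [← hp, ← hp'] at h
  rw [← hp] at hfm hsub1
  rw [← hp'] at hgm hsub1
  rcases hm.eq_or_lt with hm | hm
  · rw [← hm] at hsub1 ⊢
    linarith
  by_cases hh : μ.real D / 2 ≤ μ.real D * p
  · have hh' := h.1 hh
    have h1 : 1 / 2 ≤ p := by by_contra hc; nlinarith
    have h2 : 1 / 2 ≤ r := by by_contra hc; nlinarith
    have h3 : 0 ≤ μ.real D * ((2 * p - 1) * (1 - p)) :=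
      mul_nonneg hm.le (mul_nonneg (by linarith) (by linarith))
    have h4 : 0 ≤ μ.real D * ((2 * r - 1) * (1 - r)) :=
      mul_nonneg hm.le (mul_nonneg (by linarith) (by linarith))
    linarith
  · have hh' := not_le.1 fun hc => hh (h.2 hc)
    have h1 : p ≤ 1 / 2 := by by_contra hc; nlinarith
    have h2 : r ≤ 1 / 2 := by by_contra hc; nlinarith
    have h3 : 0 ≤ μ.real D * (p * (1 - 2 * p)) :=
      mul_nonneg hm.le (mul_nonneg (by linarith) (by linarith))
    have h4 : 0 ≤ μ.real D * (r * (1 - 2 * r)) :=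
      mul_nonneg hm.le (mul_nonneg (by linarith) (by linarith))
    linarith

theorem pullCondEnt_le_of_refines (hf : Measurable f) (hζ : IsPartition ζ)
    (hα : IsPartition α) (hg : ∀ D ∈ ζ, ∃ A ∈ α, D ⊆ g ⁻¹' A) {s : ℝ} (hs : 0 < s)
    (hs1 : s ≤ 1) :
    pullCondEnt μ f ζ α ≤ α.card * s + (1 - Real.log s) * pullDist μ α f g := by
  have hlog : 0 ≤ -Real.log s := by linarith [Real.log_nonpos hs.le hs1]
  have key : ∀ D ∈ ζ, μ.real D * ∑ A ∈ α, Real.negMulLog (μ.real (D ∩ f ⁻¹' A) / μ.real D)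
      ≤ μ.real D * (α.card * s) + (1 - Real.log s) *
        ∑ A ∈ α, μ.real (D ∩ symmDiff (f ⁻¹' A) (g ⁻¹' A)) := by
    intro D hD
    obtain ⟨B, hB, hDB⟩ := hg D hD
    by_cases hm : μ.real D = 0
    · rw [hm, zero_mul, zero_mul, zero_add]
      exact mul_nonneg (by linarith) (Finset.sum_nonneg fun _ _ => measureReal_nonneg)
    set p : Set X → ℝ := fun A => μ.real (D ∩ f ⁻¹' A) / μ.real D with hp
    have hp0 : ∀ A, 0 ≤ p A := fun A => (measureReal_inter_div_mem D _).1
    have hsum : ∑ A ∈ α, p A = 1 := by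
      rw [hp, ← Finset.sum_div, sum_measureReal_inter_preimage hf hα, div_self hm]
    have hsplit : p B + ∑ A ∈ α.erase B, p A = 1 := by
      rw [Finset.add_sum_erase _ _ hB, hsum]
    have h1 : ∑ A ∈ α, Real.negMulLog (p A) ≤ α.card * s + (1 - Real.log s) * (1 - p B) := by
      rw [← Finset.add_sum_erase _ _ hB]
      have h2 : ∑ A ∈ α.erase B, Real.negMulLog (p A)
          ≤ ∑ A ∈ α.erase B, (s + p A * -Real.log s) :=
        Finset.sum_le_sum fun A _ => negMulLog_le_add_mul hs (hp0 A)
      rw [Finset.sum_add_distrib, ← Finset.sum_mul, Finset.sum_const, nsmul_eq_mul] at h2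
      have h3 : ((α.erase B).card : ℝ) * s ≤ α.card * s := by
        gcongr
        exact Finset.erase_subset _ _
      have h4 := Real.negMulLog_le_one_sub_self (hp0 B)
      have h5 : ∑ A ∈ α.erase B, p A = 1 - p B := by linarith
      rw [h5] at h2
      linarith
    have h6 : μ.real D * (1 - p B) ≤ ∑ A ∈ α, μ.real (D ∩ symmDiff (f ⁻¹' A) (g ⁻¹' A)) := by
      have h7 : μ.real D * (1 - p B) = μ.real (D \ f ⁻¹' B) := by
        have h8 := measureReal_inter_add_sdiff (μ := μ) (s := D) (hf (hα.1 B hB))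
        have h9 := measureReal_mul_div_inter (μ := μ) D (f ⁻¹' B)
        simp only [hp]
        linarith
      rw [h7]
      refine le_trans (measureReal_mono ?_) (Finset.single_le_sum (f := fun A =>
        μ.real (D ∩ symmDiff (f ⁻¹' A) (g ⁻¹' A))) (fun _ _ => measureReal_nonneg) hB)
      exact fun x hx => ⟨hx.1, Or.inr ⟨hDB hx.1, hx.2⟩⟩
    calc _ ≤ μ.real D * (α.card * s + (1 - Real.log s) * (1 - p B)) :=
          mul_le_mul_of_nonneg_left h1 measureReal_nonneg
      _ = μ.real D * (α.card * s) + (1 - Real.log s) * (μ.real D * (1 - p B)) := by ring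
      _ ≤ _ := by
          have := mul_le_mul_of_nonneg_left h6 (by linarith : 0 ≤ 1 - Real.log s)
          linarith
  refine (Finset.sum_le_sum key).trans (le_of_eq ?_)
  rw [Finset.sum_add_distrib, ← Finset.sum_mul, sum_measureReal_eq_one hζ, one_mul,
    ← Finset.mul_sum, sum_inter_symmDiff_eq_pullDist hζ]

end PartitionEntropy

section SequenceEntropy

attribute [local instance] Classical.propDecidable

variable {X : Type*} {G : Type*} {T : G → X → X} {α : Finset (Set X)} {Λ : Set G}

theorem seqJoin_succ (w : ℕ → G) (k : ℕ) :
    seqJoin T w α (k + 1) = pullJoin (T (w k)) (seqJoin T w α k) α := rfl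

variable [MeasurableSpace X] {μ : Measure X}

/-- The pullbacks of `α` under `T w`, `w ∈ Λ`, are totally bounded for `pullDist`. -/
def IsPrecompactAlong (μ : Measure X) (T : G → X → X) (α : Finset (Set X)) (Λ : Set G) : Prop :=
  ∀ ε > 0, ∃ F : Finset G, ∀ w ∈ Λ, ∃ g ∈ F, pullDist μ α (T w) (T g) < ε

theorem IsPrecompactAlong.of_finite (hΛ : Λ.Finite) : IsPrecompactAlong μ T α Λ :=
  fun _ hε => ⟨hΛ.toFinset, fun w hw => ⟨w, hΛ.mem_toFinset.2 hw, pullDist_self.trans_lt hε⟩⟩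

theorem IsPartition.seqJoin (hT : ∀ w, Measurable (T w)) (hα : IsPartition α) (w : ℕ → G)
    (k : ℕ) : IsPartition (seqJoin T w α k) := by
  induction k with
  | zero => exact isPartition_singleton_univ
  | succ k ih => exact ih.pullJoin (hT _) hα

theorem exists_isPartition_refining (hT : ∀ w, Measurable (T w)) (hα : IsPartition α)
    (F : Finset G) :
    ∃ η, IsPartition η ∧ ∀ g ∈ F, ∀ E ∈ η, ∃ A ∈ α, E ⊆ T g ⁻¹' A := by
  induction F using Finset.induction_on with
  | empty => exact ⟨_, isPartition_singleton_univ, by simp⟩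
  | insert a F _ ih =>
    obtain ⟨η, hη, h⟩ := ih
    refine ⟨_, hη.pullJoin (hT a) hα, fun g hg E hE => ?_⟩
    obtain ⟨D, hD, A, hA, rfl⟩ := mem_pullJoin.1 hE
    rcases Finset.mem_insert.1 hg with rfl | hg
    · exact ⟨A, hA, inter_subset_right⟩
    · obtain ⟨B, hB, hDB⟩ := h g hg D hD
      exact ⟨B, hB, inter_subset_left.trans hDB⟩

variable [IsProbabilityMeasure μ]

theorem partEnt_nonneg (ζ : Finset (Set X)) : 0 ≤ partEnt μ ζ :=
  Finset.sum_nonneg fun _ _ => Real.negMulLog_nonneg ENNReal.toReal_nonneg measureReal_le_one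

theorem partEnt_singleton_univ : partEnt μ {univ} = 0 := by simp [partEnt]

theorem partEnt_seqJoin_le (hT : ∀ w, Measurable (T w)) (hα : IsPartition α) (w : ℕ → G)
    (k : ℕ) : partEnt μ (seqJoin T w α k) ≤ α.card * k := by
  induction k with
  | zero => exact (partEnt_singleton_univ.trans (by simp)).le
  | succ k ih =>
    have hk := hα.seqJoin hT w k
    rw [seqJoin_succ, partEnt_pullJoin (hT _) hk hα]
    have := pullCondEnt_le_card (μ := μ) (f := T (w k)) (α := α) hk
    push_cast
    linarith

theorem partEnt_seqJoin_div_le (hT : ∀ w, Measurable (T w)) (hα : IsPartition α) (w : ℕ → G)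
    (k : ℕ) : partEnt μ (seqJoin T w α k) / (k : ℝ) ≤ α.card :=
  div_le_of_le_mul₀ (Nat.cast_nonneg _) (Nat.cast_nonneg _) (partEnt_seqJoin_le hT hα w k)

theorem seqEnt_le_of_eventually {c : ℝ} {w : ℕ → G}
    (h : ∀ᶠ k : ℕ in atTop, partEnt μ (seqJoin T w α k) / (k : ℝ) ≤ c) : seqEnt μ T w α ≤ c := by
  refine limsup_le_of_le ?_ h
  exact IsBoundedUnder.isCoboundedUnder_le
    ⟨0, eventually_map.2 (Eventually.of_forall fun k =>
      div_nonneg (partEnt_nonneg _) (Nat.cast_nonneg k))⟩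

theorem seqEnt_le_card (hT : ∀ w, Measurable (T w)) (hα : IsPartition α) (w : ℕ → G) :
    seqEnt μ T w α ≤ α.card :=
  seqEnt_le_of_eventually (Eventually.of_forall (partEnt_seqJoin_div_le hT hα w))

theorem le_seqEnt (hT : ∀ w, Measurable (T w)) (hα : IsPartition α) {w : ℕ → G} {c : ℝ}
    (h : ∀ k : ℕ, c * k ≤ partEnt μ (seqJoin T w α k)) : c ≤ seqEnt μ T w α := by
  refine le_limsup_of_frequently_le (Eventually.frequently ?_)
    ⟨α.card, eventually_map.2 (Eventually.of_forall (partEnt_seqJoin_div_le hT hα w))⟩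
  filter_upwards [eventually_gt_atTop 0] with k hk
  rw [le_div_iff₀ (by exact_mod_cast hk)]
  exact h k

theorem IsPrecompactAlong.seqEnt_le_zero (hT : ∀ w, Measurable (T w)) (hα : IsPartition α)
    (h : IsPrecompactAlong μ T α Λ) {w : ℕ → G} (hw : ∀ i, w i ∈ Λ) : seqEnt μ T w α ≤ 0 := by
  refine le_of_forall_pos_le_add fun ε hε => ?_
  rw [zero_add]
  have hcard : (0 : ℝ) < α.card + 1 := by positivity
  obtain ⟨s, hs, hs1, hsε⟩ : ∃ s : ℝ, 0 < s ∧ s ≤ 1 ∧ α.card * s ≤ ε / 4 := by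
    refine ⟨min 1 (ε / (4 * (α.card + 1))), by positivity, min_le_left _ _, ?_⟩
    calc (α.card : ℝ) * min 1 (ε / (4 * (α.card + 1)))
        ≤ (α.card + 1) * (ε / (4 * (α.card + 1))) := by
          gcongr
          · linarith
          · exact min_le_right _ _
      _ = ε / 4 := by field_simp
  have hL : 0 < 1 - Real.log s := by linarith [Real.log_nonpos hs.le hs1]
  obtain ⟨F, hF⟩ := h (ε / 4 / (1 - Real.log s)) (by positivity)
  obtain ⟨η, hη, hηF⟩ := exists_isPartition_refining hT hα F
  have hstep : ∀ k : ℕ, partEnt μ (pullJoin id (seqJoin T w α k) η)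
      ≤ partEnt μ (pullJoin id {univ} η) + ε / 2 * k := by
    intro k
    induction k with
    | zero => simp [seqJoin]
    | succ k ih =>
      have hk : IsPartition (pullJoin id (seqJoin T w α k) η) :=
        (hα.seqJoin hT w k).pullJoin measurable_id hη
      obtain ⟨g, hg, hd⟩ := hF (w k) (hw k)
      rw [seqJoin_succ, pullJoin_id_pullJoin, partEnt_pullJoin (hT _) hk hα]
      have h1 : pullCondEnt μ (T (w k)) (pullJoin id (seqJoin T w α k) η) α
          ≤ α.card * s + (1 - Real.log s) * pullDist μ α (T (w k)) (T g) := by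
        refine pullCondEnt_le_of_refines (hT _) hk hα (fun S hS => ?_) hs hs1
        obtain ⟨D, _, E, hE, rfl⟩ := mem_pullJoin.1 hS
        obtain ⟨A, hA, hEA⟩ := hηF g hg E hE
        exact ⟨A, hA, inter_subset_right.trans hEA⟩
      rw [lt_div_iff₀ hL] at hd
      push_cast
      linarith
  set C := partEnt μ (pullJoin id {univ} η)
  refine seqEnt_le_of_eventually ?_
  filter_upwards [eventually_gt_atTop 0, eventually_ge_atTop ⌈2 * C / ε⌉₊] with k hk hkC
  have hk' : (0 : ℝ) < k := by exact_mod_cast hk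
  have h2 := Nat.ceil_le.1 hkC
  rw [div_le_iff₀ hε] at h2
  rw [div_le_iff₀ hk']
  have h3 := hstep k
  rw [partEnt_pullJoin measurable_id (hα.seqJoin hT w k) hη] at h3
  have h4 := pullCondEnt_nonneg (μ := μ) (f := id) (ζ := seqJoin T w α k) (α := η)
  linarith

theorem exists_le_pullCondEnt (hT : ∀ w, Measurable (T w)) (hα : IsPartition α) {ε : ℝ}
    (hε : 0 < ε) (hΛ : ∀ F : Finset G, ∃ w ∈ Λ, ∀ g ∈ F, ε ≤ pullDist μ α (T w) (T g))
    {ζ : Finset (Set X)} (hζ : IsPartition ζ) (F : Finset G) :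
    ∃ w ∈ Λ, w ∉ F ∧ ε / 8 ≤ pullCondEnt μ (T w) ζ α := by
  by_contra! h
  set σ : G → Finset (Set X × Set X) := fun w =>
    (ζ ×ˢ α).filter fun p => μ.real p.1 / 2 ≤ μ.real (p.1 ∩ T w ⁻¹' p.2) with hσ
  have hfin : (σ '' (Λ \ F)).Finite := by
    refine ((ζ ×ˢ α).powerset.finite_toSet).subset ?_
    rintro _ ⟨w, _, rfl⟩
    exact Finset.mem_coe.2 (Finset.mem_powerset.2 (Finset.filter_subset _ _))
  obtain ⟨R, hR, hRσ⟩ := Finset.subset_set_image_iff.1 (hfin.coe_toFinset.subset)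
  obtain ⟨w, hw, hwd⟩ := hΛ (F ∪ R)
  by_cases hwF : w ∈ F
  · have := hwd w (Finset.mem_union_left _ hwF)
    rw [pullDist_self] at this
    linarith
  · have hwσ : σ w ∈ R.image σ := by
      rw [hRσ, hfin.mem_toFinset]
      exact ⟨w, ⟨hw, hwF⟩, rfl⟩
    obtain ⟨g, hg, hgw⟩ := Finset.mem_image.1 hwσ
    have h1 := hwd g (Finset.mem_union_right _ hg)
    have h2 := pullDist_le_of_half_iff (μ := μ) (hT w) (hT g) hζ hα fun D hD A hA => by
      have := Finset.ext_iff.1 hgw (D, A)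
      simp only [hσ, Finset.mem_filter, Finset.mk_mem_product hD hA, true_and] at this
      exact this.symm
    have h3 := h w hw hwF
    have h4 := h g (hR hg).1 (hR hg).2
    have h5 := pullCondVar_le_pullCondEnt (μ := μ) (f := T w) (ζ := ζ) (α := α)
    have h6 := pullCondVar_le_pullCondEnt (μ := μ) (f := T g) (ζ := ζ) (α := α)
    linarith

theorem isPrecompactAlong_of_seqEnt_le_zero (hT : ∀ w, Measurable (T w)) (hα : IsPartition α)
    (h : ∀ w : ℕ → G, EnumIn w Λ → seqEnt μ T w α ≤ 0) : IsPrecompactAlong μ T α Λ := by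
  unfold IsPrecompactAlong
  by_contra! hne
  obtain ⟨ε, hε, hΛ⟩ := hne
  have hex : ∀ s : Finset (Set X) × Finset G, ∃ w, IsPartition s.1 →
      w ∈ Λ ∧ w ∉ s.2 ∧ ε / 8 ≤ pullCondEnt μ (T w) s.1 α := by
    intro s
    by_cases hs : IsPartition s.1
    · obtain ⟨w, hw⟩ := exists_le_pullCondEnt hT hα hε hΛ hs s.2
      exact ⟨w, fun _ => hw⟩
    · obtain ⟨w, _⟩ := hΛ ∅
      exact ⟨w, fun hs' => absurd hs' hs⟩
  choose W hW using hex
  let S : ℕ → Finset (Set X) × Finset G := fun n =>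
    Nat.rec ({univ}, ∅) (fun _ s => (pullJoin (T (W s)) s.1 α, insert (W s) s.2)) n
  let w : ℕ → G := fun n => W (S n)
  have hS : ∀ n, (S n).1 = seqJoin T w α n := by
    intro n
    induction n with
    | zero => rfl
    | succ n ih => rw [seqJoin_succ, ← ih]
  have hpart : ∀ n, IsPartition (S n).1 := fun n => hS n ▸ hα.seqJoin hT w n
  have hmem : ∀ n m, n < m → w n ∈ (S m).2 := by
    intro n m hnm
    induction m, hnm using Nat.le_induction with
    | base => exact Finset.mem_insert_self _ _
    | succ m _ ih => exact Finset.mem_insert_of_mem ih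
  have hlt : ∀ n m, n < m → w n ≠ w m := fun n m hnm heq => by
    have hm := hmem n m hnm
    rw [heq] at hm
    exact (hW (S m) (hpart m)).2.1 hm
  have hinj : Function.Injective w := fun n m heq => by
    by_contra hnm
    rcases lt_or_gt_of_ne hnm with hnm | hnm
    exacts [hlt n m hnm heq, hlt m n hnm heq.symm]
  have hent : ∀ k : ℕ, ε / 8 * k ≤ partEnt μ (seqJoin T w α k) := by
    intro k
    induction k with
    | zero => simpa using partEnt_nonneg _
    | succ k ih =>
      rw [seqJoin_succ, partEnt_pullJoin (hT _) (hα.seqJoin hT w k) hα, ← hS]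
      have := (hW (S k) (hpart k)).2.2
      rw [← hS] at ih
      push_cast
      linarith
  have h1 := le_seqEnt hT hα hent
  have h2 := h w ⟨hinj, fun n => (hW (S n) (hpart n)).1⟩
  linarith

end SequenceEntropy

section Directions

open scoped Pointwise

attribute [local instance] Classical.propDecidable

variable {X : Type*} [MeasurableSpace X] {μ : Measure X} {α : Finset (Set X)}

theorem IsPrecompactAlong.mono {G : Type*} {T : G → X → X} {Λ Λ' : Set G}
    (h : IsPrecompactAlong μ T α Λ') (hΛ : Λ ⊆ Λ') : IsPrecompactAlong μ T α Λ :=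
  fun ε hε => (h ε hε).imp fun _ hF w hw => hF w (hΛ hw)

variable {G : Type*} [AddCommGroup G] {T : G → X → X}

theorem pullDist_add_right (hT : ∀ w, MeasurePreserving (T w) μ μ)
    (hadd : ∀ v w, T (v + w) = T v ∘ T w) (hα : IsPartition α) (a b u : G) :
    pullDist μ α (T (a + u)) (T (b + u)) = pullDist μ α (T a) (T b) := by
  rw [hadd, hadd, pullDist_comp (hT a).measurable (hT b).measurable (hT u) hα]

variable [IsProbabilityMeasure μ]

theorem IsPrecompactAlong.add (hT : ∀ w, MeasurePreserving (T w) μ μ)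
    (hadd : ∀ v w, T (v + w) = T v ∘ T w) (hα : IsPartition α) {Λ Λ' : Set G}
    (h : IsPrecompactAlong μ T α Λ) (h' : IsPrecompactAlong μ T α Λ') :
    IsPrecompactAlong μ T α (Λ + Λ') := by
  intro ε hε
  obtain ⟨F, hF⟩ := h (ε / 2) (by positivity)
  obtain ⟨F', hF'⟩ := h' (ε / 2) (by positivity)
  refine ⟨F + F', ?_⟩
  rintro _ ⟨w, hw, w', hw', rfl⟩
  obtain ⟨g, hg, hd⟩ := hF w hw
  obtain ⟨g', hg', hd'⟩ := hF' w' hw'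
  refine ⟨g + g', Finset.add_mem_add hg hg', ?_⟩
  have h1 := pullDist_triangle (μ := μ) (α := α) (T (w + w')) (T (g + w')) (T (g + g'))
  rw [pullDist_add_right hT hadd hα, add_comm g w', add_comm g g',
    pullDist_add_right hT hadd hα] at h1
  rw [add_comm g g']
  dsimp only
  linarith

theorem IsPrecompactAlong.sum (hT : ∀ w, MeasurePreserving (T w) μ μ)
    (hadd : ∀ v w, T (v + w) = T v ∘ T w) (hα : IsPartition α) {ι : Type*} (s : Finset ι)
    {Λ : ι → Set G} (h : ∀ i, IsPrecompactAlong μ T α (Λ i)) :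
    IsPrecompactAlong μ T α (∑ i ∈ s, Λ i) := by
  induction s using Finset.induction_on with
  | empty => exact .of_finite (by simp)
  | insert a s ha ih =>
    rw [Finset.sum_insert ha]
    exact (h a).add hT hadd hα ih

/-- Every lattice point is, up to a bounded error, a sum of points of the tubes along a basis. -/
theorem exists_finite_univ_eq_sum_LamQ_add {q : ℕ} [NeZero q] {v : Fin q → Fin q → ℝ}
    (hv : ∀ i, v i 0 = 1) (hli : LinearIndependent ℝ v) :
    ∃ R : Set (Fin q → ℤ), R.Finite ∧ univ ⊆ (∑ i, LamQ (v i) fun _ => 1) + R := by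
  let K : Fin q → ℤ := fun j => ⌈∑ i, (|v i j| + 1 / 2)⌉
  refine ⟨Icc (-K) K, finite_Icc _ _, fun w _ => ?_⟩
  let b := basisOfLinearIndependentOfCardEqFinrank hli (by simp)
  let t : Fin q → ℝ := b.repr fun j => (w j : ℝ)
  have ht : ∀ j, ∑ i, t i * v i j = w j := by
    intro j
    have := congrFun (b.sum_repr fun j => (w j : ℝ)) j
    simpa [b, t] using this
  let u : Fin q → Fin q → ℤ := fun i j => round (⌊t i⌋ * v i j)
  have hu : ∀ i, u i ∈ LamQ (v i) fun _ => 1 := by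
    intro i j _
    have h0 : u i 0 = ⌊t i⌋ := by simp [u, hv]
    have h1 := abs_le.1 (abs_sub_round (⌊t i⌋ * v i j))
    rw [h0]
    simp only [u]
    constructor <;> linarith [h1.1, h1.2]
  have hr : ∀ j, |((w - ∑ i, u i) j : ℝ)| ≤ K j := by
    intro j
    have h1 : ((w - ∑ i, u i) j : ℝ) = ∑ i, (t i * v i j - u i j) := by
      rw [Finset.sum_sub_distrib, ht]
      simp
    rw [h1]
    refine (Finset.abs_sum_le_sum_abs _ _).trans (le_trans (Finset.sum_le_sum fun i _ => ?_)
      (Int.le_ceil _))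
    have h2 : t i * v i j - u i j = Int.fract (t i) * v i j
        + (⌊t i⌋ * v i j - round (⌊t i⌋ * v i j)) := by
      simp only [u, Int.fract]
      ring
    rw [h2]
    refine (abs_add_le _ _).trans (add_le_add ?_ (abs_sub_round _))
    rw [abs_mul, abs_of_nonneg (Int.fract_nonneg _)]
    exact mul_le_of_le_one_left (abs_nonneg _) (Int.fract_lt_one _).le
  refine ⟨∑ i, u i, Set.finsetSum_mem_finsetSum _ _ _ fun i _ => hu i, w - ∑ i, u i, ⟨?_, ?_⟩,
    add_sub_cancel _ _⟩
  · intro j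
    have := (abs_le.1 (hr j)).1
    exact_mod_cast this
  · intro j
    have := (abs_le.1 (hr j)).2
    exact_mod_cast this

end Directions

/-- if some sequence entropy of `α` is positive, then there do
not exist `q` linearly independent directions `v_i = (1,β^i_2,…,β^i_q)` with
`h^{v_i,*}_μ(α) = 0`; i.e. there are at most `q-1` linearly independent such
directions. -/
theorem at_most_q_sub_one_null_directions
    {X : Type*} [MetricSpace X] [CompactSpace X] [MeasurableSpace X] [BorelSpace X]
    (q : ℕ) [NeZero q] (hq : 2 ≤ q)
    (μ : Measure X) [IsProbabilityMeasure μ] (T : (Fin q → ℤ) → X → X)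
    (hT : IsZqMPS μ T) (α : Finset (Set X)) (hα : IsPartition α)
    (h : ∃ w : ℕ → Fin q → ℤ, Function.Injective w ∧ 0 < seqEnt μ T w α) :
    ∀ v : Fin q → (Fin q → ℝ), (∀ i, v i 0 = 1) →
      (∀ i, hStarQ μ T (v i) α = 0) → ¬ LinearIndependent ℝ v := by
  intro v hv hzero hli
  obtain ⟨-, -, hadd, hmp⟩ := hT
  have hmeas : ∀ w, Measurable (T w) := fun w => (hmp w).measurable
  have hprec : ∀ i, IsPrecompactAlong μ T α (LamQ (v i) fun _ => 1) := by
    refine fun i => isPrecompactAlong_of_seqEnt_le_zero hmeas hα fun w hw => ?_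
    rw [← hzero i]
    refine le_ciSup (f := fun w : {w : ℕ → Fin q → ℤ // EnumIn w (LamQ (v i) fun _ => 1)} =>
      seqEnt μ T w.1 α) ⟨α.card, ?_⟩ ⟨w, hw⟩
    rintro _ ⟨w', rfl⟩
    exact seqEnt_le_card hmeas hα w'.1
  obtain ⟨R, hR, hsub⟩ := exists_finite_univ_eq_sum_LamQ_add hv hli
  obtain ⟨w, -, hw⟩ := h
  have huniv : IsPrecompactAlong μ T α univ :=
    ((IsPrecompactAlong.sum hmp hadd hα Finset.univ hprec).add hmp hadd hα (.of_finite hR)).mono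
      hsub
  exact hw.not_ge (huniv.seqEnt_le_zero hmeas hα fun i => mem_univ (w i))

end Directional
end

section
/- Let $(X,\mathcal{B}_X,\mu,T)$ be a $\mathbb{Z}^q$-MPS ($q\ge 2$). The following are equivalent: (a) there exist $q$ linearly independent direction vectors $\vec v_1,\dots,\vec v_q$ of the form $\vec v_i=(1,\beta^i_2,\dots,\beta^i_q)\in\mathbb{R}^q$ such that $\mu$ has $\vec v_i$-discrete spectrum for every $i=1,\dots,q$; (b) $\mu$ has discrete spectrum. -/
open MeasureTheory Filter Set
open scoped ENNReal Topology

namespace Directional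

noncomputable section

attribute [local instance] Classical.propDecidable

variable {X : Type*} [MeasurableSpace X] {G : Type*}

end

section Zq

open scoped Pointwise

variable {X : Type*} [MeasurableSpace X] {q : ℕ}

theorem korbit_mono {G : Type*} (μ : Measure X) (T : G → X → X) {Λ Λ' : Set G} (h : Λ ⊆ Λ')
    (B : Set X) : korbit μ T Λ B ⊆ korbit μ T Λ' B :=
  fun _ ⟨w, hw, hg⟩ => ⟨w, h hw, hg⟩

theorem isCompact_closure_korbit_iff {G : Type*} (μ : Measure X) (T : G → X → X) (Λ : Set G)
    (B : Set X) :
    IsCompact (closure (korbit μ T Λ B)) ↔ TotallyBounded (korbit μ T Λ B) :=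
  ⟨fun h => h.totallyBounded.subset subset_closure,
    fun h => h.closure.isCompact_of_isClosed isClosed_closure⟩

theorem totallyBounded_korbit_of_finite {G : Type*} (μ : Measure X) (T : G → X → X) {Λ : Set G}
    (hΛ : Λ.Finite) (B : Set X) : TotallyBounded (korbit μ T Λ B) := by
  have h : korbit μ T Λ B = ⋃ w ∈ Λ, korbit μ T {w} B := by
    ext g
    simp [korbit]
  rw [h]
  refine (hΛ.biUnion fun w _ => Set.Subsingleton.finite ?_).totallyBounded
  rintro g ⟨_, rfl, hg⟩ g' ⟨_, rfl, hg'⟩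
  exact Lp.ext (hg.trans hg'.symm)

/-- If every measurable set has a totally bounded orbit along `Λ₁` and along `Λ₂`, then also
along `Λ₁ + Λ₂`. -/
theorem totallyBounded_korbit_add {G : Type*} [AddCommMonoid G] (μ : Measure X)
    [IsProbabilityMeasure μ] (T : G → X → X) (hadd : ∀ v w, T (v + w) = T v ∘ T w)
    (hmp : ∀ w, MeasurePreserving (T w) μ μ) {Λ₁ Λ₂ : Set G}
    (h₁ : ∀ B, MeasurableSet B → TotallyBounded (korbit μ T Λ₁ B))
    (h₂ : ∀ B, MeasurableSet B → TotallyBounded (korbit μ T Λ₂ B))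
    {B : Set X} (hB : MeasurableSet B) : TotallyBounded (korbit μ T (Λ₁ + Λ₂) B) := by
  rw [Metric.totallyBounded_iff]
  intro ε hε
  obtain ⟨t, htsub, htfin, htcov⟩ := Metric.finite_approx_of_totallyBounded (h₁ B hB) (ε / 2)
    (half_pos hε)
  have horb : ∀ g ∈ t, ∃ w, (g : X → ℝ) =ᵐ[μ] fun x => B.indicator (fun _ => (1 : ℝ)) (T w x) :=
    fun g hg => (htsub hg).imp fun _ h => h.2
  choose! w hw using horb
  have hU : TotallyBounded (⋃ g ∈ t, korbit μ T Λ₂ (T (w g) ⁻¹' B)) :=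
    (totallyBounded_biUnion htfin).2 fun g _ => h₂ _ ((hmp _).measurable hB)
  obtain ⟨s, hsfin, hscov⟩ := Metric.totallyBounded_iff.1 hU (ε / 2) (half_pos hε)
  refine ⟨s, hsfin, ?_⟩
  rintro f ⟨_, ⟨a, ha, b, hb, rfl⟩, hf⟩
  have hmem : MemLp (fun x => B.indicator (fun _ => (1 : ℝ)) (T a x)) 2 μ :=
    ((memLp_indicator_const 2 hB (1 : ℝ) (Or.inr (measure_ne_top μ B)))).comp_measurePreserving
      (hmp a)
  have hga : hmem.toLp _ ∈ korbit μ T Λ₁ B := ⟨a, ha, hmem.coeFn_toLp⟩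
  obtain ⟨g, hgt, hg⟩ := mem_iUnion₂.1 (htcov hga)
  let U := Lp.compMeasurePreserving (E := ℝ) (p := 2) (T b) (hmp b)
  have hUf : U (hmem.toLp _) = f := by
    refine Lp.ext ((Lp.coeFn_compMeasurePreserving _ (hmp b)).trans ?_)
    refine ((hmp b).quasiMeasurePreserving.ae_eq_comp hmem.coeFn_toLp).trans ?_
    refine EventuallyEq.trans (Eq.eventuallyEq ?_) hf.symm
    funext x
    simp [hadd]
  have hUg : U g ∈ korbit μ T Λ₂ (T (w g) ⁻¹' B) := by
    refine ⟨b, hb, (Lp.coeFn_compMeasurePreserving _ (hmp b)).trans ?_⟩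
    exact (hmp b).quasiMeasurePreserving.ae_eq_comp (hw g hgt)
  have hdist : dist f (U g) < ε / 2 := by
    rw [← hUf, (Lp.isometry_compMeasurePreserving (hmp b)).dist_eq]
    exact hg
  obtain ⟨y, hys, hy⟩ := mem_iUnion₂.1 (hscov (mem_iUnion₂.2 ⟨g, hgt, hUg⟩))
  refine mem_iUnion₂.2 ⟨y, hys, ?_⟩
  rw [Metric.mem_ball] at hy ⊢
  linarith [dist_triangle f (U g) y]

theorem totallyBounded_korbit_sum {G ι : Type*} [AddCommMonoid G] (μ : Measure X)
    [IsProbabilityMeasure μ] (T : G → X → X) (hadd : ∀ v w, T (v + w) = T v ∘ T w)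
    (hmp : ∀ w, MeasurePreserving (T w) μ μ) (Λ : ι → Set G)
    (h : ∀ i B, MeasurableSet B → TotallyBounded (korbit μ T (Λ i) B)) (s : Finset ι) :
    ∀ B, MeasurableSet B → TotallyBounded (korbit μ T (∑ i ∈ s, Λ i) B) := by
  classical
  induction s using Finset.induction_on with
  | empty =>
    intro B _
    rw [Finset.sum_empty]
    exact totallyBounded_korbit_of_finite μ T Set.finite_zero B
  | insert i s his ih =>
    intro B hB
    rw [Finset.sum_insert his]
    exact totallyBounded_korbit_add μ T hadd hmp (h i) ih hB

/-- The tubes along a spanning family of directions generate `ℤ^q` up to a finite set. -/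
theorem exists_finite_add_sum_LamQ_eq_univ [NeZero q] (v : Fin q → Fin q → ℝ)
    (hv0 : ∀ i, v i 0 = 1) (hv : LinearIndependent ℝ v) :
    ∃ F : Set (Fin q → ℤ), F.Finite ∧ F + ∑ i, LamQ (v i) (fun _ => 1) = Set.univ := by
  let C : Fin q → ℤ := fun j => ⌈∑ i, (|v i j| + 1 / 2)⌉
  refine ⟨Set.Icc (-C) C, Set.finite_Icc _ _, Set.eq_univ_of_forall fun w => ?_⟩
  obtain ⟨t, ht⟩ : ∃ t : Fin q → ℝ, ∑ i, t i • v i = fun j => (w j : ℝ) := by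
    have := hv.span_eq_top_of_card_eq_finrank (by simp)
    exact (Submodule.mem_span_range_iff_exists_fun ℝ).1 (this ▸ Submodule.mem_top)
  let p : Fin q → Fin q → ℤ := fun i j => round (v i j * (⌊t i⌋ : ℝ))
  have hp : ∀ i, p i ∈ LamQ (v i) (fun _ => 1) := by
    intro i j _
    have h0 : p i 0 = ⌊t i⌋ := by simp [p, hv0]
    have := abs_le.1 (abs_sub_round (v i j * (⌊t i⌋ : ℝ)))
    rw [h0]
    simp only [p]
    constructor <;> linarith [this.1, this.2]
  have habs : ∀ j, |((w j - ∑ i, p i j : ℤ) : ℝ)| ≤ ∑ i, (|v i j| + 1 / 2) := by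
    intro j
    have hj : (w j : ℝ) = ∑ i, t i * v i j := by
      have := congrFun ht j
      simp only [Finset.sum_apply, Pi.smul_apply, smul_eq_mul] at this
      exact this.symm
    push_cast
    rw [hj, ← Finset.sum_sub_distrib]
    refine (Finset.abs_sum_le_sum_abs _ _).trans (Finset.sum_le_sum fun i _ => ?_)
    have hr := abs_sub_round (v i j * (⌊t i⌋ : ℝ))
    have hf : |(t i - ⌊t i⌋) * v i j| ≤ |v i j| := by
      rw [abs_mul]
      refine mul_le_of_le_one_left (abs_nonneg _) (abs_le.2 ⟨?_, ?_⟩)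
      · linarith [Int.floor_le (t i)]
      · linarith [Int.lt_floor_add_one (t i)]
    calc |t i * v i j - (p i j : ℝ)|
        = |(t i - ⌊t i⌋) * v i j + (v i j * ⌊t i⌋ - (p i j : ℝ))| := by ring_nf
      _ ≤ _ := (abs_add_le _ _).trans (add_le_add hf hr)
  have hC : ∀ j, |w j - ∑ i, p i j| ≤ C j := by
    intro j
    have := (habs j).trans (Int.le_ceil _)
    exact_mod_cast this
  refine ⟨w - ∑ i, p i, ⟨fun j => ?_, fun j => ?_⟩, ∑ i, p i,
    Set.finsetSum_mem_finsetSum _ _ _ fun i _ => hp i, sub_add_cancel _ _⟩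
  · simpa using (abs_le.1 (hC j)).1
  · simpa using (abs_le.1 (hC j)).2

theorem exists_linearIndependent_direction [NeZero q] :
    ∃ v : Fin q → Fin q → ℝ, (∀ i, v i 0 = 1) ∧ LinearIndependent ℝ v := by
  let v : Fin q → Fin q → ℝ := fun i j => if j = 0 ∨ j = i then 1 else 0
  refine ⟨v, fun i => by simp [v], Fintype.linearIndependent_iff.2 fun g hg => ?_⟩
  have hne : ∀ i, i ≠ 0 → g i = 0 := by
    intro i hi
    have := congrFun hg i
    simpa [v, hi, Finset.sum_apply] using this
  have h0 : g 0 = 0 := by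
    have := congrFun hg 0
    simp only [Finset.sum_apply, Pi.smul_apply, smul_eq_mul, v, true_or, if_true, mul_one,
      Pi.zero_apply] at this
    rwa [Finset.sum_eq_single 0 (fun i _ hi => hne i hi) (by simp)] at this
  intro i
  by_cases hi : i = 0
  · rw [hi, h0]
  · exact hne i hi

end Zq

/-- a `ℤ^q`-system has discrete spectrum iff it has directional
discrete spectrum along `q` linearly independent directions. -/
theorem discreteSpectrumQ_iff_q_directions
    {X : Type*} [MetricSpace X] [CompactSpace X] [MeasurableSpace X] [BorelSpace X]
    (q : ℕ) [NeZero q] (hq : 2 ≤ q)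
    (μ : Measure X) [IsProbabilityMeasure μ] (T : (Fin q → ℤ) → X → X)
    (hT : IsZqMPS μ T) :
    (∃ v : Fin q → (Fin q → ℝ), (∀ i, v i 0 = 1) ∧ LinearIndependent ℝ v ∧
        ∀ i, dirKronQ μ T (v i) (fun _ => 1) = {B : Set X | MeasurableSet B}) ↔
      kronQ μ T = {B : Set X | MeasurableSet B} := by
  constructor
  · rintro ⟨v, hv0, hv, hK⟩
    obtain ⟨F, hF, hFv⟩ := exists_finite_add_sum_LamQ_eq_univ v hv0 hv
    refine Set.Subset.antisymm (fun B hB => hB.1) fun B hB => ⟨hB, ?_⟩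
    rw [isCompact_closure_korbit_iff, ← hFv]
    refine totallyBounded_korbit_add μ T hT.2.2.1 hT.2.2.2
      (fun A _ => totallyBounded_korbit_of_finite μ T hF A)
      (totallyBounded_korbit_sum μ T hT.2.2.1 hT.2.2.2 _ (fun i A hA => ?_) _) hB
    have hA' : A ∈ dirKronQ μ T (v i) (fun _ => 1) := by
      rw [hK i]
      exact hA
    exact (isCompact_closure_korbit_iff ..).1 hA'.2
  · intro hK
    obtain ⟨v, hv0, hv⟩ := exists_linearIndependent_direction (q := q)
    refine ⟨v, hv0, hv, fun i => Set.Subset.antisymm (fun B hB => hB.1) fun B hB => ⟨hB, ?_⟩⟩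
    have hB' : B ∈ kronQ μ T := by
      rw [hK]
      exact hB
    exact hB'.2.of_isClosed_subset isClosed_closure
      (closure_mono (korbit_mono μ T (Set.subset_univ _) B))

end Directional
end
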